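/- arXiv:2006.15763 — 4 statements merged into one kernel-verified Lean document; each statement's English description precedes it below -/
import Mathlib

section
/- Let u and v be nonzero vectors in a real inner product space. Then the sine of the angle between u and v satisfies sin(∠(u, v)) ≤ ‖u − v‖ / ‖u‖. -/
/-- For nonzero vectors `u`, `v` in a real inner product space, the sine of
the angle between them satisfies `sin (angle u v) ≤ ‖u - v‖ / ‖u‖`. -/
theorem sin_angle_le_dist_div_norm
    {E : Type*} [NormedAddCommGroup E] [InnerProductSpace ℝ E]
    (u v : E) (hu : u ≠ 0) (hv : v ≠ 0) :
    Real.sin (InnerProductGeometry.angle u v) ≤ ‖u - v‖ / ‖u‖ := by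
  rw [le_div_iff₀ (norm_pos_iff.mpr hu)]
  refine abs_le_of_sq_le_sq' ?_ (norm_nonneg _) |>.2
  have hdist := norm_sub_sq_real u v
  rw [← InnerProductGeometry.cos_angle_mul_norm_mul_norm u v] at hdist
  have htrig := Real.sin_sq_add_cos_sq (InnerProductGeometry.angle u v)
  rw [mul_pow, hdist]
  linear_combination
    sq_nonneg (‖v‖ - Real.cos (InnerProductGeometry.angle u v) * ‖u‖) + ‖u‖ ^ 2 * htrig
end

section
/- Let u and v be nonzero vectors in a real inner product space and let s ≥ 0. If ‖u − v‖ ≤ 2s, then the squared normalized correlation satisfies (⟨u, v⟩ / (‖u‖ ‖v‖))² ≥ 1 − 4s² / ‖u‖². -/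
open scoped RealInnerProductSpace

/-- For nonzero vectors `u`, `v` in a real inner product space and `s ≥ 0`
with `‖u - v‖ ≤ 2 * s`, the squared normalized correlation satisfies
`(⟪u, v⟫ / (‖u‖ * ‖v‖))² ≥ 1 - 4 * s² / ‖u‖²`. -/
theorem sq_normalized_correlation_ge
    {E : Type*} [NormedAddCommGroup E] [InnerProductSpace ℝ E]
    (u v : E) (hu : u ≠ 0) (hv : v ≠ 0)
    (s : ℝ) (hs : 0 ≤ s) (h : ‖u - v‖ ≤ 2 * s) :
    (⟪u, v⟫ / (‖u‖ * ‖v‖)) ^ 2 ≥ 1 - 4 * s ^ 2 / ‖u‖ ^ 2 := by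
  have hu' : 0 < ‖u‖ := norm_pos_iff.mpr hu
  have hv' : 0 < ‖v‖ := norm_pos_iff.mpr hv
  have hsub : ‖u‖ ^ 2 - 2 * ⟪u, v⟫ + ‖v‖ ^ 2 ≤ 4 * s ^ 2 := by
    rw [← norm_sub_sq_real]
    nlinarith [norm_nonneg (u - v)]
  have hrw : 1 - 4 * s ^ 2 / ‖u‖ ^ 2 =
      (‖u‖ ^ 2 - 4 * s ^ 2) * ‖v‖ ^ 2 / (‖u‖ * ‖v‖) ^ 2 := by
    field_simp
  rw [ge_iff_le, hrw, div_pow]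
  gcongr
  nlinarith [sq_nonneg (⟪u, v⟫ - ‖v‖ ^ 2),
    mul_le_mul_of_nonneg_right hsub (sq_nonneg ‖v‖)]
end

section
/- Let K ≥ 2 and let μ_1, ..., μ_K be nonzero vectors in ℝ^d with mutual coherence μ(U) = max_{p ≠ q} |⟨μ_p, μ_q⟩| / (‖μ_p‖ ‖μ_q‖), and let u_max = max_k ‖μ_k‖. Suppose there exist indices p ≠ q with ‖μ_p‖ = u_max, a point z ∈ ℝ^d, and a real s ≥ 0 such that ‖z − μ_p‖ ≤ s and ‖z − μ_q‖ ≤ s. Then μ(U)² ≥ 1 − 4s² / u_max². -/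
open scoped RealInnerProductSpace

/-- The squared normalized correlation of two nonzero vectors is at least one minus their squared
distance relative to the squared norm of the first. -/
theorem one_sub_norm_sub_sq_div_le_correlation_sq {E : Type*} [NormedAddCommGroup E]
    [InnerProductSpace ℝ E] {a b : E} (ha : a ≠ 0) (hb : b ≠ 0) :
    1 - ‖a - b‖ ^ 2 / ‖a‖ ^ 2 ≤ (|⟪a, b⟫| / (‖a‖ * ‖b‖)) ^ 2 := by
  have ha' : 0 < ‖a‖ := norm_pos_iff.2 ha
  have hb' : 0 < ‖b‖ := norm_pos_iff.2 hb
  rw [norm_sub_sq_real, div_pow, sq_abs, ← sub_nonneg]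
  have h : ⟪a, b⟫ ^ 2 / (‖a‖ * ‖b‖) ^ 2 -
      (1 - (‖a‖ ^ 2 - 2 * ⟪a, b⟫ + ‖b‖ ^ 2) / ‖a‖ ^ 2) =
      ((⟪a, b⟫ - ‖b‖ ^ 2) / (‖a‖ * ‖b‖)) ^ 2 := by
    field_simp
    ring
  rw [h]
  positivity

/-- For `K ≥ 2` nonzero landmark vectors `μ 1, ..., μ K` in `ℝ^d` with mutual
coherence `coh = max_{p ≠ q} |⟪μ p, μ q⟫| / (‖μ p‖ * ‖μ q‖)` and `umax = max_k ‖μ k‖`: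
if there are indices `p ≠ q` with `‖μ p‖ = umax`, a point `z` and `s ≥ 0` such that
`‖z - μ p‖ ≤ s` and `‖z - μ q‖ ≤ s`, then `coh² ≥ 1 - 4 s² / umax²`. -/
theorem mutual_coherence_sq_ge_of_close_landmarks
    (d K : ℕ) (hK : 2 ≤ K)
    (μ : Fin K → EuclideanSpace ℝ (Fin d))
    (hμ : ∀ k, μ k ≠ 0)
    (coh umax : ℝ)
    (hcoh : coh = (Finset.univ.offDiag : Finset (Fin K × Fin K)).sup'
      (⟨(⟨0, by omega⟩, ⟨1, by omega⟩), Finset.mem_offDiag.2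
        ⟨Finset.mem_univ _, Finset.mem_univ _, by simp [Fin.ext_iff]⟩⟩)
      (fun pq => |⟪μ pq.1, μ pq.2⟫| / (‖μ pq.1‖ * ‖μ pq.2‖)))
    (humax : umax = (Finset.univ : Finset (Fin K)).sup'
      (Finset.univ_nonempty_iff.2 ⟨⟨0, by omega⟩⟩) (fun k => ‖μ k‖))
    (p q : Fin K) (hpq : p ≠ q) (hp : ‖μ p‖ = umax)
    (z : EuclideanSpace ℝ (Fin d)) (s : ℝ) (hs : 0 ≤ s)
    (hzp : ‖z - μ p‖ ≤ s) (hzq : ‖z - μ q‖ ≤ s) :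
    coh ^ 2 ≥ 1 - 4 * s ^ 2 / umax ^ 2 := by
  have hle : |⟪μ p, μ q⟫| / (‖μ p‖ * ‖μ q‖) ≤ coh := by
    rw [hcoh]
    exact Finset.le_sup' (fun pq : Fin K × Fin K => |⟪μ pq.1, μ pq.2⟫| / (‖μ pq.1‖ * ‖μ pq.2‖))
      (b := (p, q)) (Finset.mem_offDiag.2 ⟨Finset.mem_univ p, Finset.mem_univ q, hpq⟩)
  have hdist : ‖μ p - μ q‖ ≤ 2 * s := by
    have := norm_sub_le_norm_sub_add_norm_sub (μ p) z (μ q)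
    rw [norm_sub_rev (μ p) z] at this
    linarith
  calc 1 - 4 * s ^ 2 / umax ^ 2 = 1 - (2 * s) ^ 2 / ‖μ p‖ ^ 2 := by rw [hp]; ring
    _ ≤ 1 - ‖μ p - μ q‖ ^ 2 / ‖μ p‖ ^ 2 := by gcongr
    _ ≤ (|⟪μ p, μ q⟫| / (‖μ p‖ * ‖μ q‖)) ^ 2 :=
      one_sub_norm_sub_sq_div_le_correlation_sq (hμ p) (hμ q)
    _ ≤ coh ^ 2 := by gcongr
end

section
/- (Theorem 1, as stated in the paper, with the implicit normalization hypothesis B ≤ 1 made explicit.) Fix d ≥ 2 and K ≥ 2, let C_d = (3/2)(1 + log(d)/d) γ_d V_d with γ_d = 1 + d·log(d·log d) and V_d = 2 Γ(1/2)^d / (d Γ(d/2)) the volume of the d-dimensional Euclidean unit ball, and let C_p > 0 be any constant. Set B = C_d C_p (⌊(K/2)^{1/d}⌋^{−1} + 1) K^{−1/d} and assume B ≤ 1. Let μ_1, ..., μ_K be nonzero vectors in ℝ^d with mutual coherence μ(U) and u_max = max_k ‖μ_k‖. Suppose the average distortion s ≥ 0 satisfies s ≤ B, and suppose there exist indices p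 ≠ q with ‖μ_p‖ = u_max and a point z ∈ ℝ^d with ‖z − μ_p‖ ≤ s and ‖z − μ_q‖ ≤ s. Then μ(U)² ≥ 1 − (4 C_d C_p / (u_max² K^{1/d})) (⌊(K/2)^{1/d}⌋^{−1} + 1). -/
open scoped RealInnerProductSpace

/-- The squared sine of the angle between `x` and `y`, scaled by `‖x‖ ^ 2`, is the squared distance
from `x` to the line spanned by `y`, hence at most `‖x - y‖ ^ 2`. -/
theorem one_sub_norm_sub_sq_div_le_cos_sq {E : Type*} [NormedAddCommGroup E]
    [InnerProductSpace ℝ E] {x y : E} (hx : x ≠ 0) (hy : y ≠ 0) :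
    1 - ‖x - y‖ ^ 2 / ‖x‖ ^ 2 ≤ (|⟪x, y⟫| / (‖x‖ * ‖y‖)) ^ 2 := by
  have hx' : 0 < ‖x‖ := norm_pos_iff.2 hx
  have hy' : 0 < ‖y‖ := norm_pos_iff.2 hy
  have key : (|⟪x, y⟫| / (‖x‖ * ‖y‖)) ^ 2 - (1 - ‖x - y‖ ^ 2 / ‖x‖ ^ 2)
      = ((⟪x, y⟫ / ‖y‖ - ‖y‖) / ‖x‖) ^ 2 := by
    rw [div_pow, sq_abs, norm_sub_sq_real]
    field_simp
    ring
  linarith [sq_nonneg ((⟪x, y⟫ / ‖y‖ - ‖y‖) / ‖x‖)]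

/-- Theorem 1 as stated in the paper, with the implicit normalization
hypothesis `B ≤ 1` made explicit: with `C_d = (3/2)(1 + log d / d) γ_d V_d`,
`γ_d = 1 + d log(d log d)`, `V_d = 2 Γ(1/2)^d / (d Γ(d/2))`, `C_p > 0`,
`B = C_d C_p (⌊(K/2)^{1/d}⌋⁻¹ + 1) K^{-1/d} ≤ 1`: if the average distortion `s ≥ 0`
satisfies `s ≤ B`, and there are indices `p ≠ q` with `‖μ p‖ = umax` and a point `z`
with `‖z - μ p‖ ≤ s` and `‖z - μ q‖ ≤ s`, then
`coh² ≥ 1 - (4 C_d C_p / (umax² K^{1/d})) (⌊(K/2)^{1/d}⌋⁻¹ + 1)`. -/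
theorem mutual_coherence_sq_lower_bound_paper
    (d K : ℕ) (hd : 2 ≤ d) (hK : 2 ≤ K)
    (γd Vd Cd Cp B : ℝ)
    (hγd : γd = 1 + (d : ℝ) * Real.log ((d : ℝ) * Real.log d))
    (hVd : Vd = 2 * Real.Gamma (1 / 2) ^ d / ((d : ℝ) * Real.Gamma ((d : ℝ) / 2)))
    (hCd : Cd = (3 / 2) * (1 + Real.log d / (d : ℝ)) * γd * Vd)
    (hCp : 0 < Cp)
    (hB : B = Cd * Cp * ((⌊((K : ℝ) / 2) ^ ((d : ℝ)⁻¹)⌋ : ℝ)⁻¹ + 1)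
      * (K : ℝ) ^ (-(d : ℝ)⁻¹))
    (hB1 : B ≤ 1)
    (μ : Fin K → EuclideanSpace ℝ (Fin d))
    (hμ : ∀ k, μ k ≠ 0)
    (coh umax : ℝ)
    (hcoh : coh = (Finset.univ.offDiag : Finset (Fin K × Fin K)).sup'
      (⟨(⟨0, by omega⟩, ⟨1, by omega⟩), Finset.mem_offDiag.2
        ⟨Finset.mem_univ _, Finset.mem_univ _, by simp [Fin.ext_iff]⟩⟩)
      (fun pq => |⟪μ pq.1, μ pq.2⟫| / (‖μ pq.1‖ * ‖μ pq.2‖)))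
    (humax : umax = (Finset.univ : Finset (Fin K)).sup'
      (Finset.univ_nonempty_iff.2 ⟨⟨0, by omega⟩⟩) (fun k => ‖μ k‖))
    (s : ℝ) (hs : 0 ≤ s) (hsB : s ≤ B)
    (p q : Fin K) (hpq : p ≠ q) (hp : ‖μ p‖ = umax)
    (z : EuclideanSpace ℝ (Fin d))
    (hzp : ‖z - μ p‖ ≤ s) (hzq : ‖z - μ q‖ ≤ s) :
    coh ^ 2 ≥ 1 - (4 * Cd * Cp / (umax ^ 2 * (K : ℝ) ^ ((d : ℝ)⁻¹)))
      * ((⌊((K : ℝ) / 2) ^ ((d : ℝ)⁻¹)⌋ : ℝ)⁻¹ + 1) := by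
  have hcos : |⟪μ p, μ q⟫| / (‖μ p‖ * ‖μ q‖) ≤ coh := by
    rw [hcoh]
    exact Finset.le_sup' (fun pq : Fin K × Fin K => |⟪μ pq.1, μ pq.2⟫| / (‖μ pq.1‖ * ‖μ pq.2‖))
      (b := (p, q)) (by simp [hpq])
  have hcos_sq : (|⟪μ p, μ q⟫| / (‖μ p‖ * ‖μ q‖)) ^ 2 ≤ coh ^ 2 :=
    pow_le_pow_left₀ (by positivity) hcos 2
  have hdist : ‖μ p - μ q‖ ≤ 2 * s := by
    have h := norm_sub_le_norm_sub_add_norm_sub (μ p) z (μ q)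
    rw [norm_sub_rev (μ p) z] at h
    linarith
  have hdist_sq : ‖μ p - μ q‖ ^ 2 ≤ 4 * B := by
    nlinarith [norm_nonneg (μ p - μ q)]
  have hangle := one_sub_norm_sub_sq_div_le_cos_sq (hμ p) (hμ q)
  have hdiv : ‖μ p - μ q‖ ^ 2 / ‖μ p‖ ^ 2 ≤ 4 * B / ‖μ p‖ ^ 2 := by gcongr
  have hbound : 4 * Cd * Cp / (umax ^ 2 * (K : ℝ) ^ ((d : ℝ)⁻¹))
      * ((⌊((K : ℝ) / 2) ^ ((d : ℝ)⁻¹)⌋ : ℝ)⁻¹ + 1) = 4 * B / ‖μ p‖ ^ 2 := by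
    rw [hB, hp, Real.rpow_neg (Nat.cast_nonneg K), div_eq_mul_inv, div_eq_mul_inv, mul_inv]
    ring
  rw [hbound]
  linarith
end
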